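/- Let F be a finite set, let (a_n)_{n∈F} and (c_n)_{n∈F} be bounded linear operators on ℓ²(ℤ^d), and let v ∈ ℓ²(ℤ^d). Then ‖∑_{n∈F} a_n^* c_n v‖² ≤ ‖∑_{n∈F} a_n^* a_n‖ · ⟨(∑_{n∈F} c_n^* c_n) v, v⟩, where ‖·‖ on the right denotes the operator norm. -/

import Mathlib

/- STATEMENT 4: vector form of the operator Cauchy–Schwarz inequality:
   ‖∑_{n∈F} aₙ* cₙ v‖² ≤ ‖∑_{n∈F} aₙ* aₙ‖ · ⟨(∑_{n∈F} cₙ* cₙ) v, v⟩. -/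

noncomputable section
open scoped ENNReal InnerProductSpace

/-- `ℓ²(I)` -/
abbrev Hs (I : Type) : Type := lp (fun _ : I => ℂ) 2

/-- The quadratic form of `∑ bₙ* bₙ` is the sum of squared norms. -/
theorem re_inner_sum_adjoint_mul {I ι : Type} (F : Finset ι) (b : ι → (Hs I →L[ℂ] Hs I))
    (v : Hs I) :
    Complex.re (@inner ℂ _ _ v ((∑ n ∈ F, (ContinuousLinearMap.adjoint (b n)) * b n) v)) =
      ∑ n ∈ F, ‖b n v‖ ^ 2 := by
  rw [sum_apply, inner_sum, Complex.re_sum]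
  refine Finset.sum_congr rfl fun n _ => ?_
  rw [mul_apply_eq_comp, ContinuousLinearMap.adjoint_inner_right]
  exact inner_self_eq_norm_sq (𝕜 := ℂ) (b n v)

theorem vector_cauchy_schwarz (d : ℕ) {ι : Type} (F : Finset ι)
    (a c : ι → (Hs (Fin d → ℤ) →L[ℂ] Hs (Fin d → ℤ))) (v : Hs (Fin d → ℤ)) :
    ‖∑ n ∈ F, (ContinuousLinearMap.adjoint (a n)) ((c n) v)‖ ^ 2 ≤
      ‖∑ n ∈ F, (ContinuousLinearMap.adjoint (a n)) * a n‖ *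
        Complex.re (@inner ℂ _ _ v ((∑ n ∈ F, (ContinuousLinearMap.adjoint (c n)) * c n) v)) := by
  set w := ∑ n ∈ F, (ContinuousLinearMap.adjoint (a n)) ((c n) v) with hw
  set A := ∑ n ∈ F, (ContinuousLinearMap.adjoint (a n)) * a n with hA
  rw [re_inner_sum_adjoint_mul]
  have h1 : ‖w‖ ^ 2 ≤ ∑ n ∈ F, ‖a n w‖ * ‖c n v‖ := by
    have h : ‖w‖ ^ 2 = Complex.re (@inner ℂ _ _ w w) :=
      (inner_self_eq_norm_sq (𝕜 := ℂ) w).symm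
    rw [h]
    nth_rewrite 2 [hw]
    rw [inner_sum, Complex.re_sum]
    refine Finset.sum_le_sum fun n _ => ?_
    rw [ContinuousLinearMap.adjoint_inner_right]
    exact re_inner_le_norm (𝕜 := ℂ) (a n w) (c n v)
  have h2 : ∑ n ∈ F, ‖a n w‖ ^ 2 ≤ ‖A‖ * ‖w‖ ^ 2 := by
    rw [← re_inner_sum_adjoint_mul, ← hA]
    calc Complex.re (@inner ℂ _ _ w (A w)) ≤ ‖w‖ * ‖A w‖ :=
          re_inner_le_norm (𝕜 := ℂ) w (A w)
      _ ≤ ‖w‖ * (‖A‖ * ‖w‖) := by gcongr; exact A.le_opNorm w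
      _ = ‖A‖ * ‖w‖ ^ 2 := by ring
  have h3 := Finset.sum_mul_sq_le_sq_mul_sq F (fun n => ‖a n w‖) (fun n => ‖c n v‖)
  have hC : 0 ≤ ∑ n ∈ F, ‖c n v‖ ^ 2 := Finset.sum_nonneg fun n _ => sq_nonneg _
  have h4 : (‖w‖ ^ 2) * ‖w‖ ^ 2 ≤ (‖A‖ * ∑ n ∈ F, ‖c n v‖ ^ 2) * ‖w‖ ^ 2 := by
    calc (‖w‖ ^ 2) * ‖w‖ ^ 2 = (‖w‖ ^ 2) ^ 2 := by ring
      _ ≤ (∑ n ∈ F, ‖a n w‖ * ‖c n v‖) ^ 2 := by gcongr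
      _ ≤ (∑ n ∈ F, ‖a n w‖ ^ 2) * ∑ n ∈ F, ‖c n v‖ ^ 2 := h3
      _ ≤ (‖A‖ * ‖w‖ ^ 2) * ∑ n ∈ F, ‖c n v‖ ^ 2 := by gcongr
      _ = _ := by ring
  rcases (sq_nonneg ‖w‖).eq_or_lt with h0 | h0
  · rw [← h0]; exact mul_nonneg (norm_nonneg A) hC
  · exact le_of_mul_le_mul_right h4 h0
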